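/- Let γ* = exp(-(π/e)·(e^{1/6} - 1)) and let γ ∈ [γ*, 1). For α > 0 with α ≠ 1 define D(α,γ) = ( π·|α-1| / (-e·α·log γ) )^{|α-1|/2}, C₁(α,γ) = √α · e^{1/(12α)} · D(α,γ), and C₂(α,γ) = √α · e^{-α/12} / D(α,γ). Then for every λ > 0: (1) if 0 < α < 1, then ψ(α,λ) < C₁(α,γ) · e^{-αλ} · E_α( ((α/γ)·λ)^α ); (2) if α > 1, then ψ(α,λ) > C₂(α,γ) · e^{-αλ} · E_α( (α·γ·λ)^α ). -/

import Mathlib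

open Real Filter Topology

/-- The Poisson probabilities `p_i(λ) = e^{-λ} λ^i / i!`. -/
noncomputable def poissonP (l : ℝ) (i : ℕ) : ℝ :=
  Real.exp (-l) * l ^ i / (Nat.factorial i)

/-- `ψ(α,λ) = ∑_{i=0}^∞ (p_i(λ))^α`. -/
noncomputable def psiPoisson (α l : ℝ) : ℝ :=
  ∑' i, (poissonP l i) ^ α

/-- The Mittag–Leffler function `E_α(x) = ∑_{n=0}^∞ x^n / Γ(αn+1)`. -/
noncomputable def mittagLeffler (α x : ℝ) : ℝ :=
  ∑' n : ℕ, x ^ n / Real.Gamma (α * n + 1)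

/-- The logarithm of `Γ` with the growing part of Stirling's approximation removed. -/
noncomputable def logGammaRemainder (x : ℝ) : ℝ :=
  Real.log (Real.Gamma x) - (x - 1 / 2) * Real.log x + x

theorem logGammaRemainder_sub_add_one {x : ℝ} (hx : 0 < x) :
    logGammaRemainder x - logGammaRemainder (x + 1) =
      (x + 1 / 2) * Real.log (1 + x⁻¹) - 1 := by
  have h : 1 + x⁻¹ = (x + 1) / x := by field_simp
  rw [h, Real.log_div (by positivity) hx.ne', logGammaRemainder, logGammaRemainder,
    Real.Gamma_add_one hx.ne', Real.log_mul hx.ne' (Real.Gamma_pos_of_pos hx).ne']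
  ring

theorem logGammaRemainder_add_one_le {x : ℝ} (hx : 0 < x) :
    logGammaRemainder (x + 1) ≤ logGammaRemainder x := by
  have h := Real.le_log_one_add_of_nonneg (inv_nonneg.2 hx.le)
  have h2 : (x + 1 / 2) * (2 * x⁻¹ / (x⁻¹ + 2)) = 1 := by field_simp; ring
  have h3 := mul_le_mul_of_nonneg_left h (by positivity : 0 ≤ x + 1 / 2)
  linarith [logGammaRemainder_sub_add_one hx]

theorem logGammaRemainder_sub_add_one_le {x : ℝ} (hx : 0 < x) :
    logGammaRemainder x - logGammaRemainder (x + 1) ≤ 1 / (12 * x) - 1 / (12 * (x + 1)) := by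
  rw [logGammaRemainder_sub_add_one hx]
  set t : ℝ := 1 / (2 * x + 1) with ht
  have ht0 : 0 < t := by positivity
  have ht1 : t ^ 2 < 1 := by
    have : t < 1 := by rw [ht, div_lt_one (by positivity)]; linarith
    nlinarith
  have hs := (Real.hasSum_log_one_add_inv hx).mul_left (x + 1 / 2)
  have hg := ((hasSum_geometric_of_lt_one (by positivity) ht1).mul_left (1 / 3)).add
    (hasSum_ite_eq (0 : ℕ) (2 / 3 : ℝ))
  have hle := hasSum_le (fun k => ?_) hs hg
  · have h1 : 1 - t ^ 2 = 4 * x * (x + 1) / (2 * x + 1) ^ 2 := by rw [ht]; field_simp; ring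
    rw [h1] at hle
    have h2 : 1 / 3 * (4 * x * (x + 1) / (2 * x + 1) ^ 2)⁻¹ + 2 / 3 =
        1 + (1 / (12 * x) - 1 / (12 * (x + 1))) := by field_simp; ring
    linarith
  · have hxt : x + 1 / 2 = 1 / (2 * t) := by rw [ht]; field_simp
    have h1 : (x + 1 / 2) * (2 * (1 / (2 * (k : ℝ) + 1)) * t ^ (2 * k + 1)) =
        (1 / (2 * (k : ℝ) + 1)) * (t ^ 2) ^ k := by
      rw [hxt, ← pow_mul, pow_succ]; field_simp
    rw [h1]
    rcases Nat.eq_zero_or_pos k with rfl | hk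
    · norm_num
    · rw [if_neg hk.ne', add_zero]
      have : (1 : ℝ) ≤ k := by exact_mod_cast hk
      gcongr
      linarith

theorem tendsto_logGammaRemainder_add_nat {x : ℝ} (hx : 0 < x) :
    Tendsto (fun n : ℕ => logGammaRemainder (x + n)) atTop
      (𝓝 (1 / 2 * Real.log (2 * Real.pi))) := by
  rw [← tendsto_add_atTop_iff_nat 1]
  have hA := Real.BohrMollerup.tendsto_log_gamma hx
  have hS := (Stirling.tendsto_stirlingSeq_sqrt_pi).log (Real.sqrt_pos.2 Real.pi_pos).ne'
  have hM := (Real.tendsto_mul_log_one_add_div_atTop (x + 1)).comp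
    (tendsto_natCast_atTop_atTop (R := ℝ))
  have hL : Tendsto (fun n : ℕ => Real.log (1 + (x + 1) / (n : ℝ))) atTop (𝓝 0) := by
    have h := (tendsto_const_div_atTop_nhds_zero_nat (x + 1)).const_add 1
    rw [add_zero] at h
    simpa using h.log one_ne_zero
  have hT := ((((hA.const_sub (Real.log (Real.Gamma x))).add hS).add_const
    (1 / 2 * Real.log 2 + (x + 1))).sub hM).sub (hL.const_mul (x + 1 / 2))
  have hlim : Real.log (Real.Gamma x) - Real.log (Real.Gamma x) + Real.log √Real.pi +
      (1 / 2 * Real.log 2 + (x + 1)) - (x + 1) - (x + 1 / 2) * 0 =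
      1 / 2 * Real.log (2 * Real.pi) := by
    rw [Real.log_sqrt Real.pi_pos.le, Real.log_mul two_ne_zero Real.pi_ne_zero]
    ring
  rw [hlim] at hT
  refine hT.congr' ?_
  filter_upwards [eventually_gt_atTop 0] with n hn
  have hn' : (0 : ℝ) < n := by exact_mod_cast hn
  have hG := Real.BohrMollerup.f_add_nat_eq (f := Real.log ∘ Real.Gamma) (fun {y} hy => by
    simp only [Function.comp_apply]
    rw [Real.Gamma_add_one hy.ne', Real.log_mul hy.ne' (Real.Gamma_pos_of_pos hy).ne',
      add_comm]) hx (n + 1)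
  simp only [Function.comp_apply] at hG
  have h1 : 1 + (x + 1) / (n : ℝ) = (x + (n + 1)) / n := by field_simp; ring
  simp only [Function.comp_apply]
  rw [logGammaRemainder, hG, Real.BohrMollerup.logGammaSeq, Stirling.log_stirlingSeq_formula, h1,
    Real.log_div (by positivity) hn'.ne', Real.log_mul two_ne_zero hn'.ne',
    Real.log_div hn'.ne' (Real.exp_pos 1).ne', Real.log_exp]
  push_cast
  ring

theorem le_logGammaRemainder {x : ℝ} (hx : 0 < x) :
    1 / 2 * Real.log (2 * Real.pi) ≤ logGammaRemainder x := by
  have hanti : Antitone (fun n : ℕ => logGammaRemainder (x + n)) :=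
    antitone_nat_of_succ_le fun n => by
      have := logGammaRemainder_add_one_le (by positivity : 0 < x + n)
      push_cast
      rwa [← add_assoc]
  simpa using hanti.le_of_tendsto (tendsto_logGammaRemainder_add_nat hx) 0

theorem logGammaRemainder_le {x : ℝ} (hx : 0 < x) :
    logGammaRemainder x ≤ 1 / 2 * Real.log (2 * Real.pi) + 1 / (12 * x) := by
  have hmono : Monotone (fun n : ℕ => logGammaRemainder (x + n) - 1 / (12 * (x + n))) :=
    monotone_nat_of_le_succ fun n => by
      have := logGammaRemainder_sub_add_one_le (by positivity : 0 < x + n)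
      push_cast
      rw [← add_assoc]
      linarith
  have h0 : Tendsto (fun n : ℕ => 1 / (12 * (x + n))) atTop (𝓝 0) := by
    refine Tendsto.const_div_atTop ?_ 1
    exact (tendsto_atTop_add_const_left _ x tendsto_natCast_atTop_atTop).const_mul_atTop
      (by norm_num)
  have hlim := (tendsto_logGammaRemainder_add_nat hx).sub h0
  have := hmono.ge_of_tendsto hlim 0
  simp only [Nat.cast_zero, add_zero, sub_zero] at this
  linarith

theorem log_Gamma_add_one_eq {x : ℝ} (hx : 0 < x) :
    Real.log (Real.Gamma (x + 1)) =
      (x + 1 / 2) * Real.log x - x + logGammaRemainder x := by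
  rw [Real.Gamma_add_one hx.ne', Real.log_mul hx.ne' (Real.Gamma_pos_of_pos hx).ne',
    logGammaRemainder]
  ring

/-- Stirling's lower bound for the Gamma function. -/
theorem le_log_Gamma_add_one {x : ℝ} (hx : 0 < x) :
    (x + 1 / 2) * Real.log x - x + 1 / 2 * Real.log (2 * Real.pi) ≤
      Real.log (Real.Gamma (x + 1)) := by
  linarith [log_Gamma_add_one_eq hx, le_logGammaRemainder hx]

/-- Stirling's upper bound for the Gamma function. -/
theorem log_Gamma_add_one_le {x : ℝ} (hx : 0 < x) :
    Real.log (Real.Gamma (x + 1)) ≤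
      (x + 1 / 2) * Real.log x - x + 1 / 2 * Real.log (2 * Real.pi) + 1 / (12 * x) := by
  linarith [log_Gamma_add_one_eq hx, logGammaRemainder_le hx]

theorem summable_exp_sub_mul_log_Gamma (u : ℝ) {k b : ℝ} (hk : 0 < k) (hb : 0 < b) :
    Summable fun n : ℕ => Real.exp (n * u - k * Real.log (Real.Gamma (b * n + 1))) := by
  refine Summable.of_norm_bounded_eventually_nat Real.summable_exp_neg_nat ?_
  have hT : Tendsto (fun n : ℕ => Real.log (b * (n : ℝ))) atTop atTop :=
    Real.tendsto_log_atTop.comp (tendsto_natCast_atTop_atTop.const_mul_atTop hb)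
  filter_upwards [hT.eventually_ge_atTop 0, hT.eventually_ge_atTop (1 + (u + 1) / (k * b)),
    eventually_gt_atTop 0] with n h0 h1 hn
  have hn' : (0 : ℝ) < n := by exact_mod_cast hn
  rw [Real.norm_eq_abs, abs_of_pos (Real.exp_pos _)]
  gcongr
  have hS := mul_le_mul_of_nonneg_left (le_log_Gamma_add_one (by positivity : 0 < b * n)) hk.le
  have hp : 0 ≤ Real.log (2 * Real.pi) := Real.log_nonneg (by nlinarith [Real.pi_gt_three])
  have h2 := mul_le_mul_of_nonneg_left h1 (by positivity : 0 ≤ k * b * n)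
  have h3 : k * b * n * (1 + (u + 1) / (k * b)) = k * b * n + n * u + n := by field_simp; ring
  have h4 := mul_nonneg hk.le h0
  have h5 := mul_nonneg hk.le hp
  nlinarith

theorem poissonP_rpow_eq_exp (α : ℝ) {l : ℝ} (hl : 0 < l) (n : ℕ) :
    (poissonP l n) ^ α =
      Real.exp (α * (-l + n * Real.log l - Real.log (Real.Gamma (n + 1)))) := by
  have hp : 0 < poissonP l n := by unfold poissonP; positivity
  rw [Real.rpow_def_of_pos hp, poissonP, Real.log_div (by positivity) (by positivity),
    Real.log_mul (by positivity) (by positivity), Real.log_exp, Real.log_pow,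
    Real.Gamma_nat_eq_factorial, mul_comm]

theorem mittagLeffler_term_eq_exp {α c : ℝ} (hα : 0 < α) (hc : 0 < c) (n : ℕ) :
    (c ^ α) ^ n / Real.Gamma (α * n + 1) =
      Real.exp (n * (α * Real.log c) - Real.log (Real.Gamma (α * n + 1))) := by
  have hG : 0 < Real.Gamma (α * n + 1) := Real.Gamma_pos_of_pos (by positivity)
  rw [Real.exp_sub, Real.exp_log hG, Real.exp_nat_mul, Real.rpow_def_of_pos hc, mul_comm α (Real.log c)]

theorem summable_mittagLeffler_term {α c : ℝ} (hα : 0 < α) (hc : 0 < c) :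
    Summable fun n : ℕ => (c ^ α) ^ n / Real.Gamma (α * n + 1) := by
  simp_rw [mittagLeffler_term_eq_exp hα hc]
  simpa using summable_exp_sub_mul_log_Gamma (α * Real.log c) one_pos hα

theorem summable_poissonP_rpow {α l : ℝ} (hα : 0 < α) (hl : 0 < l) :
    Summable fun n : ℕ => (poissonP l n) ^ α := by
  refine ((summable_exp_sub_mul_log_Gamma (α * Real.log l) hα one_pos).mul_left
    (Real.exp (-(α * l)))).congr fun n => ?_
  rw [poissonP_rpow_eq_exp α hl, ← Real.exp_add, one_mul]
  congr 1
  ring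

/-- Gibbs' inequality for the weights `1` and `exp (1 / 6) - 1`. -/
theorem neg_one_sixth_le_relative_entropy {p : ℝ} (hp : 0 < p) (hp1 : p < 1) :
    -(1 / 6) ≤ p * Real.log p +
      (1 - p) * (Real.log (1 - p) - Real.log (Real.exp (1 / 6) - 1)) := by
  have hk : 0 < Real.exp (1 / 6) - 1 := by
    have := Real.add_one_lt_exp (by norm_num : (1 / 6 : ℝ) ≠ 0)
    linarith
  have hq : 0 < 1 - p := sub_pos.2 hp1
  have he : Real.exp (-(1 / 6)) * Real.exp (1 / 6) = 1 := by rw [← Real.exp_add]; simp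
  have h1 := Real.log_le_sub_one_of_pos (by positivity : 0 < Real.exp (-(1 / 6)) / p)
  have h2 := Real.log_le_sub_one_of_pos
    (by positivity : 0 < (Real.exp (1 / 6) - 1) * Real.exp (-(1 / 6)) / (1 - p))
  rw [Real.log_div (by positivity) hp.ne', Real.log_exp] at h1
  rw [Real.log_div (by positivity) hq.ne', Real.log_mul hk.ne' (by positivity),
    Real.log_exp] at h2
  have h1' := mul_le_mul_of_nonneg_left h1 hp.le
  have h2' := mul_le_mul_of_nonneg_left h2 hq.le
  have e1 : p * (Real.exp (-(1 / 6)) / p - 1) = Real.exp (-(1 / 6)) - p := by field_simp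
  have e2 : (1 - p) * ((Real.exp (1 / 6) - 1) * Real.exp (-(1 / 6)) / (1 - p) - 1) =
      1 - Real.exp (-(1 / 6)) - (1 - p) := by
    field_simp
    linear_combination he
  rw [e1] at h1'
  rw [e2] at h2'
  linarith

/-- The constant `D(α, γ)` written with `s = |α - 1|` and `L = -log γ`. -/
theorem log_constant_eq {s α L : ℝ} (hs : 0 < s) (hα : 0 < α) (hL : 0 < L) :
    Real.log ((Real.pi * s / (Real.exp 1 * α * L)) ^ (s / 2)) =
      s / 2 * (Real.log Real.pi + Real.log s - (1 + Real.log α + Real.log L)) := by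
  rw [Real.log_rpow (by positivity), Real.log_div (by positivity) (by positivity),
    Real.log_mul Real.pi_ne_zero hs.ne', Real.log_mul (by positivity) hL.ne',
    Real.log_mul (by positivity) hα.ne', Real.log_exp]

/-- The constant `D(α, γ)` dominates the maximum of `x ↦ (2πx)^(s/2) exp (-αLx)`. -/
theorem mul_log_sub_le_log_constant {s α L x : ℝ} (hs : 0 < s) (hα : 0 < α) (hL : 0 < L)
    (hx : 0 < x) :
    s / 2 * (Real.log (2 * Real.pi) + Real.log x) - x * (α * L) ≤
      Real.log ((Real.pi * s / (Real.exp 1 * α * L)) ^ (s / 2)) := by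
  rw [log_constant_eq hs hα hL, Real.log_mul two_ne_zero Real.pi_ne_zero]
  have h := Real.log_le_sub_one_of_pos (by positivity : 0 < 2 * (α * L * x) / s)
  rw [Real.log_div (by positivity) hs.ne', Real.log_mul two_ne_zero (by positivity),
    Real.log_mul (by positivity) hx.ne', Real.log_mul hα.ne' hL.ne'] at h
  have h' := mul_le_mul_of_nonneg_left h (by positivity : 0 ≤ s / 2)
  have e : s / 2 * (2 * (α * L * x) / s - 1) = x * (α * L) - s / 2 := by field_simp
  rw [e] at h'
  linarith

theorem le_log_constant {s α L : ℝ} (hs : 0 < s) (hα : 0 < α) (hL : 0 < L)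
    (hL' : L ≤ Real.pi / Real.exp 1 * (Real.exp (1 / 6) - 1)) :
    s / 2 * (Real.log s - Real.log α - Real.log (Real.exp (1 / 6) - 1)) ≤
      Real.log ((Real.pi * s / (Real.exp 1 * α * L)) ^ (s / 2)) := by
  have hk : 0 < Real.exp (1 / 6) - 1 := by
    have := Real.add_one_lt_exp (by norm_num : (1 / 6 : ℝ) ≠ 0)
    linarith
  have h := Real.log_le_log hL hL'
  rw [Real.log_mul (by positivity) hk.ne', Real.log_div Real.pi_ne_zero (by positivity),
    Real.log_exp] at h
  rw [log_constant_eq hs hα hL]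
  gcongr s / 2 * ?_
  linarith

theorem log_Gamma_sub_le {α x L : ℝ} (hα : 0 < α) (hα1 : α < 1) (hL : 0 < L) (hx : 0 < x) :
    Real.log (Real.Gamma (α * x + 1)) - α * Real.log (Real.Gamma (x + 1)) ≤
      1 / 2 * Real.log α + 1 / (12 * (α * x)) +
        Real.log ((Real.pi * (1 - α) / (Real.exp 1 * α * L)) ^ ((1 - α) / 2)) +
        x * (α * (Real.log α + L)) := by
  have h1 := log_Gamma_add_one_le (by positivity : 0 < α * x)
  have h2 := mul_le_mul_of_nonneg_left (le_log_Gamma_add_one hx) hα.le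
  have h3 := mul_log_sub_le_log_constant (sub_pos.2 hα1) hα hL hx
  rw [Real.log_mul hα.ne' hx.ne'] at h1
  linarith

theorem le_log_Gamma_sub {α x L : ℝ} (hα1 : 1 < α) (hL : 0 < L) (hx : 0 < x) :
    1 / 2 * Real.log α - α / (12 * x) -
        Real.log ((Real.pi * (α - 1) / (Real.exp 1 * α * L)) ^ ((α - 1) / 2)) +
        x * (α * (Real.log α - L)) ≤
      Real.log (Real.Gamma (α * x + 1)) - α * Real.log (Real.Gamma (x + 1)) := by
  have hα : 0 < α := one_pos.trans hα1
  have h1 := le_log_Gamma_add_one (by positivity : 0 < α * x)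
  have h2 := mul_le_mul_of_nonneg_left (log_Gamma_add_one_le hx) hα.le
  have h3 := mul_log_sub_le_log_constant (sub_pos.2 hα1) hα hL hx
  have e : α * (1 / (12 * x)) = α / (12 * x) := by ring
  rw [Real.log_mul hα.ne' hx.ne'] at h1
  linarith

theorem log_upper_constant_nonneg {α L : ℝ} (hα : 0 < α) (hα1 : α < 1) (hL : 0 < L)
    (hL' : L ≤ Real.pi / Real.exp 1 * (Real.exp (1 / 6) - 1)) :
    0 ≤ 1 / 2 * Real.log α + 1 / (12 * α) +
      Real.log ((Real.pi * (1 - α) / (Real.exp 1 * α * L)) ^ ((1 - α) / 2)) := by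
  have h1 := le_log_constant (sub_pos.2 hα1) hα hL hL'
  have h2 := neg_one_sixth_le_relative_entropy hα hα1
  have h3 : 1 / 12 ≤ 1 / (12 * α) := by
    gcongr
    linarith
  linarith

theorem log_lower_constant_nonpos {α L : ℝ} (hα1 : 1 < α) (hL : 0 < L)
    (hL' : L ≤ Real.pi / Real.exp 1 * (Real.exp (1 / 6) - 1)) :
    1 / 2 * Real.log α - α / 12 -
      Real.log ((Real.pi * (α - 1) / (Real.exp 1 * α * L)) ^ ((α - 1) / 2)) ≤ 0 := by
  have hα : 0 < α := one_pos.trans hα1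
  have h1 := le_log_constant (sub_pos.2 hα1) hα hL hL'
  have h2 := neg_one_sixth_le_relative_entropy (inv_pos.2 hα) (inv_lt_one_of_one_lt₀ hα1)
  have e : 1 - α⁻¹ = (α - 1) / α := by field_simp
  rw [e, Real.log_div (sub_pos.2 hα1).ne' hα.ne', Real.log_inv] at h2
  have h3 := mul_le_mul_of_nonneg_left h2 hα.le
  have e2 : ∀ z w : ℝ, α * (α⁻¹ * z + (α - 1) / α * w) = z + (α - 1) * w := by
    intro z w
    field_simp
  rw [e2] at h3
  linarith

/-- bounds for ψ(α,λ) via the Mittag–Leffler function. -/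
theorem psiPoisson_mittagLeffler_bounds
    (γ : ℝ) (hγ : Real.exp (-(Real.pi / Real.exp 1) * (Real.exp (1 / 6) - 1)) ≤ γ)
    (hγ1 : γ < 1) (α : ℝ) (hα : 0 < α) (hα1 : α ≠ 1) (l : ℝ) (hl : 0 < l) :
    (α < 1 →
      psiPoisson α l <
        Real.sqrt α * Real.exp (1 / (12 * α)) *
          (Real.pi * |α - 1| / (-(Real.exp 1 * α * Real.log γ))) ^ (|α - 1| / 2) *
          Real.exp (-(α * l)) * mittagLeffler α ((α / γ * l) ^ α)) ∧
    (1 < α →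
      psiPoisson α l >
        Real.sqrt α * Real.exp (-(α / 12)) /
          (Real.pi * |α - 1| / (-(Real.exp 1 * α * Real.log γ))) ^ (|α - 1| / 2) *
          Real.exp (-(α * l)) * mittagLeffler α ((α * γ * l) ^ α)) := by
  have hγ0 : 0 < γ := (Real.exp_pos _).trans_le hγ
  have hL : 0 < -Real.log γ := neg_pos.2 (Real.log_neg hγ0 hγ1)
  have hL' : -Real.log γ ≤ Real.pi / Real.exp 1 * (Real.exp (1 / 6) - 1) := by
    have := (Real.le_log_iff_exp_le hγ0).2 hγ
    linarith
  have hden : -(Real.exp 1 * α * Real.log γ) = Real.exp 1 * α * -Real.log γ := by ring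
  rw [hden]
  generalize hLdef : -Real.log γ = L at hL hL'
  have hsqrt : Real.sqrt α = Real.exp (1 / 2 * Real.log α) := by
    rw [Real.sqrt_eq_rpow, Real.rpow_def_of_pos hα, mul_comm]
  refine ⟨fun h1 => ?_, fun h1 => ?_⟩
  · rw [abs_of_neg (sub_neg.2 h1), neg_sub]
    have hs : 0 < 1 - α := sub_pos.2 h1
    have hc : 0 < α / γ * l := by positivity
    have hlogc : Real.log (α / γ * l) = Real.log α + L + Real.log l := by
      rw [Real.log_mul (by positivity) hl.ne', Real.log_div hα.ne' hγ0.ne', ← hLdef]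
      ring
    have hD : 0 < (Real.pi * (1 - α) / (Real.exp 1 * α * L)) ^ ((1 - α) / 2) := by positivity
    rw [psiPoisson, mittagLeffler, ← tsum_mul_left]
    have hterm : ∀ n : ℕ, Real.sqrt α * Real.exp (1 / (12 * α)) *
        (Real.pi * (1 - α) / (Real.exp 1 * α * L)) ^ ((1 - α) / 2) * Real.exp (-(α * l)) *
        (((α / γ * l) ^ α) ^ n / Real.Gamma (α * n + 1)) =
        Real.exp (1 / 2 * Real.log α + 1 / (12 * α) +
          Real.log ((Real.pi * (1 - α) / (Real.exp 1 * α * L)) ^ ((1 - α) / 2)) - α * l +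
          (n * (α * (Real.log α + L + Real.log l)) - Real.log (Real.Gamma (α * n + 1)))) := by
      intro n
      rw [mittagLeffler_term_eq_exp hα hc, hlogc, sub_eq_add_neg _ (α * l), Real.exp_add,
        Real.exp_add, Real.exp_add, Real.exp_add, Real.exp_log hD, hsqrt]
    refine Summable.tsum_lt_tsum (i := 2) (fun n => ?_) ?_ (summable_poissonP_rpow hα hl)
      ((summable_mittagLeffler_term hα hc).mul_left _)
    · rw [hterm, poissonP_rpow_eq_exp α hl]
      gcongr
      rcases Nat.eq_zero_or_pos n with rfl | hn
      · have := log_upper_constant_nonneg hα h1 hL hL'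
        simp only [Nat.cast_zero, mul_zero, zero_mul, zero_add, Real.Gamma_one, Real.log_one]
        linarith
      · have hn' : (1 : ℝ) ≤ n := by exact_mod_cast hn
        have := log_Gamma_sub_le hα h1 hL (one_pos.trans_le hn')
        have h2 : 1 / (12 * (α * n)) ≤ 1 / (12 * α) := by
          gcongr
          exact le_mul_of_one_le_right hα.le hn'
        linarith
    · rw [hterm, poissonP_rpow_eq_exp α hl]
      gcongr
      have := log_Gamma_sub_le hα h1 hL two_pos
      have h2 : 1 / (12 * (α * 2)) < 1 / (12 * α) := by
        gcongr
        linarith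
      push_cast
      linarith
  · rw [abs_of_pos (sub_pos.2 h1)]
    have hs : 0 < α - 1 := sub_pos.2 h1
    have hc : 0 < α * γ * l := by positivity
    have hlogc : Real.log (α * γ * l) = Real.log α - L + Real.log l := by
      rw [Real.log_mul (by positivity) hl.ne', Real.log_mul hα.ne' hγ0.ne', ← hLdef]
      ring
    have hD : 0 < (Real.pi * (α - 1) / (Real.exp 1 * α * L)) ^ ((α - 1) / 2) := by positivity
    rw [psiPoisson, mittagLeffler, ← tsum_mul_left]
    have hterm : ∀ n : ℕ, Real.sqrt α * Real.exp (-(α / 12)) /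
        (Real.pi * (α - 1) / (Real.exp 1 * α * L)) ^ ((α - 1) / 2) * Real.exp (-(α * l)) *
        (((α * γ * l) ^ α) ^ n / Real.Gamma (α * n + 1)) =
        Real.exp (1 / 2 * Real.log α + -(α / 12) -
          Real.log ((Real.pi * (α - 1) / (Real.exp 1 * α * L)) ^ ((α - 1) / 2)) + -(α * l) +
          (n * (α * (Real.log α - L + Real.log l)) - Real.log (Real.Gamma (α * n + 1)))) := by
      intro n
      rw [mittagLeffler_term_eq_exp hα hc, hlogc, Real.exp_add, Real.exp_add,
        Real.exp_sub (_ + _), Real.exp_add, Real.exp_log hD, hsqrt]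
    refine Summable.tsum_lt_tsum (i := 2) (fun n => ?_) ?_
      ((summable_mittagLeffler_term hα hc).mul_left _) (summable_poissonP_rpow hα hl)
    · rw [hterm, poissonP_rpow_eq_exp α hl]
      gcongr
      rcases Nat.eq_zero_or_pos n with rfl | hn
      · have := log_lower_constant_nonpos h1 hL hL'
        simp only [Nat.cast_zero, mul_zero, zero_mul, zero_add, Real.Gamma_one, Real.log_one]
        linarith
      · have hn' : (1 : ℝ) ≤ n := by exact_mod_cast hn
        have := le_log_Gamma_sub h1 hL (one_pos.trans_le hn')
        have h2 : α / (12 * n) ≤ α / 12 := by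
          gcongr
          linarith
        linarith
    · rw [hterm, poissonP_rpow_eq_exp α hl]
      gcongr
      have := le_log_Gamma_sub h1 hL two_pos
      push_cast
      linarith
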